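/- Let ω₀(x) = φ(x)/|x| with φ as specified. Fix t > 0 and let f ∈ C_c^∞(ℝ²) with supp f ⊂ ℝ² \ B(0;η) for some η > 0. Then lim_{ν → 0⁺} ∫_{ℝ²} ν |∇(G_{νt} ∗ ω₀)(x)|² f(x) dx = 0; that is, any limit of the approximate viscous enstrophy defects Z^ν(ω_ν) = ν|∇ω_ν|² is a distribution supported at the origin. -/

import Mathlib

open MeasureTheory Real Metric Filter
open scoped ENNReal Topology

/-- The plane `ℝ²` with the Euclidean norm. -/
noncomputable abbrev E2 : Type := EuclideanSpace ℝ (Fin 2)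

/-- The two-dimensional heat kernel `G_λ(x) = (4πλ)⁻¹ e^{-|x|²/(4λ)}`. -/
noncomputable def heatKer (l : ℝ) (x : E2) : ℝ :=
  (4 * Real.pi * l)⁻¹ * Real.exp (-‖x‖ ^ 2 / (4 * l))

/-- The heat regularization `(G_λ ∗ f)(x) = ∫ G_λ(x-y) f(y) dy`. -/
noncomputable def heatConv (l : ℝ) (f : E2 → ℝ) (x : E2) : ℝ :=
  ∫ y, heatKer l (x - y) * f y

/-- The vorticity `ω₀(x) = φ(x)/|x|`. -/
noncomputable def omega0 (φ : E2 → ℝ) (x : E2) : ℝ := φ x / ‖x‖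

/-- The Gaussian profile is uniformly Lipschitz in the diffusion time away from the origin. -/
lemma abs_gaussian_profile_sub_le {l a : ℝ} (hl : 0 < l) (ha : 0 < a) {r s : ℝ}
    (hr : a ≤ r) (hs : a ≤ s) :
    |(4 * Real.pi * l)⁻¹ * Real.exp (-r ^ 2 / (4 * l)) -
      (4 * Real.pi * l)⁻¹ * Real.exp (-s ^ 2 / (4 * l))| ≤ 4 / (Real.pi * a ^ 3) * |r - s| := by
  have hπ := Real.pi_pos
  have hderiv : ∀ u ∈ Set.Ici a,
      HasDerivWithinAt (fun u : ℝ => (4 * Real.pi * l)⁻¹ * Real.exp (-u ^ 2 / (4 * l)))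
        ((4 * Real.pi * l)⁻¹ * (Real.exp (-u ^ 2 / (4 * l)) * (-(2 * u) / (4 * l))))
        (Set.Ici a) u := by
    intro u _
    have h1 : HasDerivAt (fun u : ℝ => -u ^ 2 / (4 * l)) (-(2 * u) / (4 * l)) u := by
      simpa using ((hasDerivAt_pow 2 u).neg.div_const (4 * l))
    exact ((h1.exp).const_mul _).hasDerivWithinAt
  have hbound : ∀ u ∈ Set.Ici a,
      ‖(4 * Real.pi * l)⁻¹ * (Real.exp (-u ^ 2 / (4 * l)) * (-(2 * u) / (4 * l)))‖ ≤
        4 / (Real.pi * a ^ 3) := by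
    intro u hu
    have hau : a ≤ u := hu
    have hu0 : 0 < u := ha.trans_le hau
    have hexp : Real.exp (-u ^ 2 / (4 * l)) ≤ 2 / (u ^ 2 / (4 * l)) ^ 2 := by
      have hv : 0 < u ^ 2 / (4 * l) := by positivity
      have := Real.quadratic_le_exp_of_nonneg hv.le
      rw [neg_div, Real.exp_neg, inv_le_comm₀ (Real.exp_pos _) (by positivity), inv_div]
      nlinarith
    have heq : ‖(4 * Real.pi * l)⁻¹ * (Real.exp (-u ^ 2 / (4 * l)) * (-(2 * u) / (4 * l)))‖ =
        (4 * Real.pi * l)⁻¹ * (Real.exp (-u ^ 2 / (4 * l)) * ((2 * u) / (4 * l))) := by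
      rw [norm_mul, norm_mul, neg_div _ (2 * u), norm_neg, Real.norm_of_nonneg (by positivity),
        Real.norm_of_nonneg (Real.exp_pos _).le, Real.norm_of_nonneg (by positivity)]
    rw [heq]
    calc (4 * Real.pi * l)⁻¹ * (Real.exp (-u ^ 2 / (4 * l)) * ((2 * u) / (4 * l)))
        ≤ (4 * Real.pi * l)⁻¹ * (2 / (u ^ 2 / (4 * l)) ^ 2 * ((2 * u) / (4 * l))) := by
          gcongr
      _ = 4 / (Real.pi * u ^ 3) := by
          field_simp
          ring
      _ ≤ 4 / (Real.pi * a ^ 3) := by gcongr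
  have := (convex_Ici a).norm_image_sub_le_of_norm_hasDerivWithin_le hderiv hbound
    (x := s) (y := r) hs hr
  simpa only [Real.norm_eq_abs] using this

lemma abs_heatKer_sub_le {l a : ℝ} (hl : 0 < l) (ha : 0 < a) {z w : E2}
    (hz : a ≤ ‖z‖) (hw : a ≤ ‖w‖) :
    |heatKer l z - heatKer l w| ≤ 4 / (Real.pi * a ^ 3) * ‖z - w‖ := by
  have hπ := Real.pi_pos
  refine (abs_gaussian_profile_sub_le hl ha hz hw).trans ?_
  gcongr
  exact abs_norm_sub_norm_le z w

lemma heatKer_nonneg {l : ℝ} (hl : 0 < l) (z : E2) : 0 ≤ heatKer l z := by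
  have hπ := Real.pi_pos
  unfold heatKer
  positivity

lemma heatKer_le {l : ℝ} (hl : 0 < l) (z : E2) : heatKer l z ≤ (4 * Real.pi * l)⁻¹ := by
  have hπ := Real.pi_pos
  unfold heatKer
  refine mul_le_of_le_one_right (by positivity) (Real.exp_le_one_iff.2 ?_)
  rw [neg_div, neg_nonpos]
  positivity

lemma continuous_heatKer (l : ℝ) : Continuous (heatKer l) := by
  unfold heatKer
  fun_prop

lemma integral_heatKer {l : ℝ} (hl : 0 < l) : ∫ z, heatKer l z = 1 := by
  have hπ := Real.pi_pos
  have h := GaussianFourier.integral_rexp_neg_mul_sq_norm (V := E2) (b := (4 * l)⁻¹)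
    (by positivity)
  have hfun : ∀ z : E2, heatKer l z =
      (4 * Real.pi * l)⁻¹ * Real.exp (-(4 * l)⁻¹ * ‖z‖ ^ 2) := by
    intro z
    unfold heatKer
    congr 2
    rw [div_eq_mul_inv]
    ring
  simp_rw [hfun]
  rw [integral_const_mul, h]
  simp only [finrank_euclideanSpace, Fintype.card_fin, Nat.cast_ofNat, div_inv_eq_mul]
  norm_num
  field_simp

lemma integrable_heatKer {l : ℝ} (hl : 0 < l) : Integrable (heatKer l) :=
  integrable_of_integral_eq_one (integral_heatKer hl)

lemma integrable_heatKer_mul {l : ℝ} (hl : 0 < l) {g : E2 → ℝ} (hg : Integrable g) (x : E2) :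
    Integrable (fun y => heatKer l (x - y) * g y) := by
  refine hg.bdd_mul (c := (4 * Real.pi * l)⁻¹)
    ((continuous_heatKer l).comp (by fun_prop)).aestronglyMeasurable (ae_of_all _ fun y => ?_)
  rw [Real.norm_of_nonneg (heatKer_nonneg hl _)]
  exact heatKer_le hl _

/-- Heat regularization does not increase the Lipschitz constant. -/
lemma abs_heatConv_sub_le_of_lipschitz {l : ℝ} (hl : 0 < l) {g : E2 → ℝ} (hg : Integrable g)
    {K : ℝ} (hK : ∀ x y, |g x - g y| ≤ K * ‖x - y‖) (x y : E2) :
    |heatConv l g x - heatConv l g y| ≤ K * ‖x - y‖ := by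
  have hswap : ∀ x, heatConv l g x = ∫ z, heatKer l z * g (x - z) := by
    intro x
    rw [← integral_sub_left_eq_self _ volume x]
    simp [heatConv]
  have hint : ∀ x, Integrable (fun z => heatKer l z * g (x - z)) := by
    intro x
    simpa using (integrable_heatKer_mul hl hg x).comp_sub_left x
  rw [hswap, hswap, ← integral_sub (hint x) (hint y), ← Real.norm_eq_abs]
  have hb : ∀ z, ‖heatKer l z * g (x - z) - heatKer l z * g (y - z)‖ ≤
      heatKer l z * (K * ‖x - y‖) := by
    intro z
    rw [← mul_sub, norm_mul, Real.norm_of_nonneg (heatKer_nonneg hl _), Real.norm_eq_abs]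
    refine mul_le_mul_of_nonneg_left ?_ (heatKer_nonneg hl _)
    simpa using hK (x - z) (y - z)
  refine (norm_integral_le_of_norm_le ((integrable_heatKer hl).mul_const _)
    (ae_of_all _ hb)).trans_eq ?_
  rw [integral_mul_const, integral_heatKer hl, one_mul]

/-- Away from the support of the initial datum, its heat regularization is Lipschitz uniformly in
the diffusion time. -/
lemma abs_heatConv_sub_le_of_far {l a : ℝ} (hl : 0 < l) (ha : 0 < a) {g : E2 → ℝ}
    (hg : Integrable g) {x x' : E2} (hx : ∀ y, g y ≠ 0 → a ≤ ‖x - y‖)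
    (hx' : ∀ y, g y ≠ 0 → a ≤ ‖x' - y‖) :
    |heatConv l g x - heatConv l g x'| ≤ (4 / (Real.pi * a ^ 3) * ∫ y, ‖g y‖) * ‖x - x'‖ := by
  unfold heatConv
  rw [← integral_sub (integrable_heatKer_mul hl hg x) (integrable_heatKer_mul hl hg x'),
    ← Real.norm_eq_abs]
  have hb : ∀ y, ‖heatKer l (x - y) * g y - heatKer l (x' - y) * g y‖ ≤
      (4 / (Real.pi * a ^ 3) * ‖x - x'‖) * ‖g y‖ := by
    intro y
    rw [← sub_mul, norm_mul]
    by_cases hy : g y = 0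
    · simp [hy]
    · refine mul_le_mul_of_nonneg_right ?_ (norm_nonneg _)
      simpa using abs_heatKer_sub_le hl ha (hx y hy) (hx' y hy)
  refine (norm_integral_le_of_norm_le (hg.norm.const_mul _) (ae_of_all _ hb)).trans_eq ?_
  rw [integral_const_mul]
  ring

/-- The truncation `φ(x) / max(|x|, δ)` of `φ(x) / |x|`. -/
noncomputable def truncatedOmega (φ : E2 → ℝ) (δ : ℝ) (x : E2) : ℝ := φ x / max ‖x‖ δ

lemma exists_lipschitz_truncatedOmega {φ : E2 → ℝ} (hφsm : ContDiff ℝ (⊤ : ℕ∞) φ)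
    (hφcpt : HasCompactSupport φ) {δ : ℝ} (hδ : 0 < δ) :
    ∃ K : ℝ, ∀ x y, |truncatedOmega φ δ x - truncatedOmega φ δ y| ≤ K * ‖x - y‖ := by
  obtain ⟨L, hL⟩ := ContDiff.lipschitzWith_of_hasCompactSupport hφcpt hφsm (by simp)
  obtain ⟨M, hM⟩ := hφcpt.exists_bound_of_continuous hφsm.continuous
  refine ⟨L / δ + M / δ ^ 2, fun x y => ?_⟩
  have hM0 : 0 ≤ M := (norm_nonneg _).trans (hM 0)
  have hmx : δ ≤ max ‖x‖ δ := le_max_right _ _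
  have hmy : δ ≤ max ‖y‖ δ := le_max_right _ _
  have hφ : |φ x - φ y| ≤ L * ‖x - y‖ := by
    simpa [dist_eq_norm] using hL.dist_le_mul x y
  have hm : |max ‖y‖ δ - max ‖x‖ δ| ≤ ‖x - y‖ := by
    refine (abs_max_sub_max_le_abs _ _ _).trans ?_
    rw [norm_sub_rev]
    exact abs_norm_sub_norm_le y x
  unfold truncatedOmega
  generalize max ‖x‖ δ = m at *
  generalize max ‖y‖ δ = n at *
  have hm0 : 0 < m := hδ.trans_le hmx
  have hn0 : 0 < n := hδ.trans_le hmy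
  have heq : φ x / m - φ y / n = (φ x - φ y) / m + φ y * (n - m) / (m * n) := by
    field_simp
    ring
  rw [heq]
  refine (abs_add_le _ _).trans ?_
  rw [abs_div, abs_div, abs_mul, abs_of_pos hm0, abs_of_pos (mul_pos hm0 hn0), add_mul]
  have hφy : |φ y| ≤ M := hM y
  refine add_le_add ?_ ?_
  · calc |φ x - φ y| / m ≤ L * ‖x - y‖ / δ := by gcongr
      _ = L / δ * ‖x - y‖ := by ring
  · calc |φ y| * |n - m| / (m * n) ≤ M * ‖x - y‖ / (δ * δ) := by gcongr
      _ = M / δ ^ 2 * ‖x - y‖ := by ring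

lemma integrable_truncatedOmega {φ : E2 → ℝ} (hφ : Continuous φ)
    (hφcpt : HasCompactSupport φ) {δ : ℝ} (hδ : 0 < δ) : Integrable (truncatedOmega φ δ) := by
  refine Continuous.integrable_of_hasCompactSupport ?_ ?_
  · exact hφ.div (by fun_prop) fun x => (hδ.trans_le (le_max_right _ _)).ne'
  · refine hφcpt.mono fun x hx => ?_
    contrapose! hx
    simp_all [truncatedOmega]

lemma integrable_indicator_inv_norm (R : ℝ) :
    Integrable (fun x : E2 => (Set.Iio R).indicator (fun r : ℝ => r⁻¹) ‖x‖) := by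
  rw [integrable_fun_norm_addHaar (μ := (volume : Measure E2))
    (f := (Set.Iio R).indicator (fun r : ℝ => r⁻¹))]
  have h1 : IntegrableOn ((Set.Iio R).indicator fun _ : ℝ => (1 : ℝ)) (Set.Ioi 0) := by
    rw [IntegrableOn, integrable_indicator_iff measurableSet_Iio, IntegrableOn,
      Measure.restrict_restrict measurableSet_Iio, Set.Iio_inter_Ioi]
    exact integrableOn_const (by simp)
  refine h1.congr_fun (fun r hr => ?_) measurableSet_Ioi
  have hr0 : r ≠ 0 := (show (0 : ℝ) < r from hr).ne'
  by_cases hrR : r < R <;> simp [hrR, hr0]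

lemma integrable_omega0 {φ : E2 → ℝ} (hφ : Continuous φ) (hφcpt : HasCompactSupport φ) :
    Integrable (omega0 φ) := by
  obtain ⟨M, hM⟩ := hφcpt.exists_bound_of_continuous hφ
  obtain ⟨R, hR⟩ := hφcpt.isCompact.isBounded.subset_ball (0 : E2)
  refine ((integrable_indicator_inv_norm R).const_mul M).mono'
    (hφ.measurable.div measurable_norm).aestronglyMeasurable (ae_of_all _ fun x => ?_)
  have hM0 : 0 ≤ M := (norm_nonneg _).trans (hM 0)
  by_cases hx : ‖x‖ < R
  · rw [Set.indicator_of_mem (by exact hx), omega0, norm_div, norm_norm, div_eq_mul_inv]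
    gcongr
    exact hM x
  · have hx0 : φ x = 0 := image_eq_zero_of_notMem_tsupport fun h => hx (by simpa using hR h)
    rw [Set.indicator_of_notMem (by exact hx), omega0, hx0]
    simp

lemma heatConv_sub {l : ℝ} (hl : 0 < l) {g h : E2 → ℝ} (hg : Integrable g) (hh : Integrable h)
    (x : E2) : heatConv l (fun y => g y - h y) x = heatConv l g x - heatConv l h x := by
  unfold heatConv
  rw [← integral_sub (integrable_heatKer_mul hl hg x) (integrable_heatKer_mul hl hh x)]
  simp_rw [mul_sub]

/-- The gradient of the heat regularization of `φ(x)/|x|` is bounded away from the origin,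
uniformly in the diffusion time. -/
lemma exists_norm_gradient_heatConv_omega0_le {φ : E2 → ℝ} (hφsm : ContDiff ℝ (⊤ : ℕ∞) φ)
    (hφcpt : HasCompactSupport φ) {η : ℝ} (hη : 0 < η) :
    ∃ C : ℝ, ∀ l : ℝ, 0 < l → ∀ x : E2, η ≤ ‖x‖ →
      ‖gradient (heatConv l (omega0 φ)) x‖ ≤ C := by
  have hπ := Real.pi_pos
  have hδ : 0 < η / 4 := by positivity
  obtain ⟨K, hK⟩ := exists_lipschitz_truncatedOmega hφsm hφcpt hδ
  have hψ := integrable_truncatedOmega hφsm.continuous hφcpt hδ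
  have hω := integrable_omega0 hφsm.continuous hφcpt
  set h : E2 → ℝ := fun y => omega0 φ y - truncatedOmega φ (η / 4) y with hh
  have hhint : Integrable h := hω.sub hψ
  have hhsupp : ∀ y, h y ≠ 0 → ‖y‖ ≤ η / 4 := by
    intro y hy
    contrapose! hy
    simp [hh, omega0, truncatedOmega, max_eq_left hy.le]
  set A : ℝ := 4 / (Real.pi * (η / 2) ^ 3) * ∫ y, ‖h y‖ with hA
  have hA0 : 0 ≤ A := mul_nonneg (by positivity) (integral_nonneg fun _ => norm_nonneg _)
  have hK0 : 0 ≤ K := by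
    obtain ⟨v, hv⟩ := exists_ne (0 : E2)
    have := (abs_nonneg _).trans (hK v 0)
    rw [sub_zero] at this
    exact nonneg_of_mul_nonneg_left this (norm_pos_iff.2 hv)
  refine ⟨A + K, fun l hl x hx => ?_⟩
  rw [gradient, LinearIsometryEquiv.norm_map]
  refine norm_fderiv_le_of_lip' ℝ (add_nonneg hA0 hK0) ?_
  have hnear : ∀ᶠ x' : E2 in 𝓝 x, 3 * η / 4 < ‖x'‖ :=
    continuous_norm.continuousAt.eventually (lt_mem_nhds (by linarith))
  filter_upwards [hnear] with x' hx'
  have hfar : ∀ z : E2, 3 * η / 4 ≤ ‖z‖ → ∀ y, h y ≠ 0 → η / 2 ≤ ‖z - y‖ := by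
    intro z hz y hy
    have h1 := hhsupp y hy
    have h2 := norm_sub_norm_le z y
    linarith
  have h1 := abs_heatConv_sub_le_of_far hl (by positivity : 0 < η / 2) hhint
    (hfar x' hx'.le) (hfar x (by linarith))
  have h2 := abs_heatConv_sub_le_of_lipschitz hl hψ hK x' x
  rw [hh, heatConv_sub hl hω hψ, heatConv_sub hl hω hψ] at h1
  rw [Real.norm_eq_abs, add_mul]
  refine le_trans (le_of_eq ?_) ((abs_add_le _ _).trans (add_le_add h1 h2))
  congr 1
  ring

/-- for `t > 0` and any test function `f` supported away from the origin,
`∫ ν |∇(G_{νt} ∗ ω₀)|² f dx → 0` as `ν → 0⁺`: any limit of the approximate viscous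
enstrophy defects is supported at the origin. -/
theorem viscous_defect_concentrates_at_origin
    (φ : E2 → ℝ) (hφsm : ContDiff ℝ (⊤ : ℕ∞) φ) (hφcpt : HasCompactSupport φ)
    (hφsupp : tsupport φ ⊆ ball (0 : E2) 1)
    (hφrad : ∃ g : ℝ → ℝ, ∀ x, φ x = g ‖x‖)
    (hφone : ∀ x : E2, ‖x‖ < 1/2 → φ x = 1)
    (t : ℝ) (ht : 0 < t)
    (f : E2 → ℝ) (hfsm : ContDiff ℝ (⊤ : ℕ∞) f) (hfcpt : HasCompactSupport f)
    (η : ℝ) (hη : 0 < η) (hfsupp : tsupport f ⊆ (ball (0 : E2) η)ᶜ) :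
    Tendsto (fun ν : ℝ =>
        ∫ x : E2, ν * ‖gradient (heatConv (ν * t) (omega0 φ)) x‖ ^ 2 * f x)
      (𝓝[>] 0) (𝓝 0) := by
  obtain ⟨C, hC⟩ := exists_norm_gradient_heatConv_omega0_le hφsm hφcpt hη
  have hfint : Integrable f := hfsm.continuous.integrable_of_hasCompactSupport hfcpt
  have hlim : Tendsto (fun ν : ℝ => ν * (C ^ 2 * ∫ x, ‖f x‖)) (𝓝[>] 0) (𝓝 0) := by
    have : Tendsto (fun ν : ℝ => ν * (C ^ 2 * ∫ x, ‖f x‖)) (𝓝 0) (𝓝 0) :=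
      (continuous_id.mul continuous_const).tendsto' _ _ (by simp)
    exact this.mono_left nhdsWithin_le_nhds
  refine squeeze_zero_norm' ?_ hlim
  filter_upwards [self_mem_nhdsWithin] with ν hν
  have hν0 : 0 < ν := hν
  have hb : ∀ x, ‖ν * ‖gradient (heatConv (ν * t) (omega0 φ)) x‖ ^ 2 * f x‖ ≤
      ν * C ^ 2 * ‖f x‖ := by
    intro x
    by_cases hx : x ∈ tsupport f
    · have hxη : η ≤ ‖x‖ := by simpa using hfsupp hx
      rw [norm_mul, Real.norm_of_nonneg (by positivity)]
      gcongr
      exact hC (ν * t) (by positivity) x hxη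
    · simp [image_eq_zero_of_notMem_tsupport hx]
  refine (norm_integral_le_of_norm_le (hfint.norm.const_mul _) (ae_of_all _ hb)).trans_eq ?_
  rw [integral_const_mul, mul_assoc]
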